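/- arXiv:2102.04868 — 6 statements merged into one kernel-verified Lean document; each statement's English description precedes it below -/
import Mathlib

section
/- Let m, n ≥ 1, let Y₁₁ be a real symmetric m×m matrix, Y₂₂ a real symmetric n×n matrix, and Y₁₂ a real m×n matrix, and let Y be the (m+n)×(m+n) block matrix with blocks Y₁₁, Y₁₂ in the first block row and Y₁₂ᵀ, Y₂₂ in the second block row. Then Y is positive semidefinite if and only if Y₂₂ is positive semidefinite and there exists a real n×m matrix W such that Y₂₂ W = Y₁₂ᵀ and Y₁₁ − Y₁₂ W is positive semidefinite. -/
open Matrix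

/-- The normal equations `Qᵀ * Q * W = Qᵀ * P` are always solvable. -/
theorem Matrix.exists_transpose_mul_self_mul_eq {k l m : Type*} [Fintype k] [Fintype l]
    (Q : Matrix k l ℝ) (P : Matrix k m ℝ) :
    ∃ W : Matrix l m ℝ, Qᵀ * Q * W = Qᵀ * P := by
  classical
  have hrange : LinearMap.range (Qᵀ * Q).mulVecLin = LinearMap.range Qᵀ.mulVecLin := by
    refine Submodule.eq_of_le_of_finrank_eq ?_ ?_
    · rw [mulVecLin_mul]
      exact LinearMap.range_comp_le_range _ _
    · exact (rank_transpose_mul_self Q).trans (rank_transpose Q).symm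
  have hcol (j : m) : ∃ w, (Qᵀ * Q) *ᵥ w = Qᵀ *ᵥ P.col j := by
    have hmem : Qᵀ.mulVecLin (P.col j) ∈ LinearMap.range (Qᵀ * Q).mulVecLin :=
      hrange ▸ LinearMap.mem_range_self _ _
    exact hmem
  choose w hw using hcol
  refine ⟨of fun i j => w j i, ?_⟩
  ext i j
  exact congrFun (hw j) i

open scoped MatrixOrder Matrix.Norms.L2Operator in
/-- In a positive semidefinite block matrix, the columns of the lower left block lie in the
range of the lower right block. -/
theorem Matrix.PosSemidef.exists_mul_eq_of_fromBlocks {m n : Type*} [Fintype m] [Fintype n]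
    {A : Matrix m m ℝ} {B : Matrix m n ℝ} {D : Matrix n n ℝ}
    (h : (fromBlocks A B Bᵀ D).PosSemidef) : ∃ W : Matrix n m ℝ, D * W = Bᵀ := by
  classical
  obtain ⟨R, hR⟩ := CStarAlgebra.nonneg_iff_eq_star_mul_self.mp h.nonneg
  rw [star_eq_conjTranspose, ← fromCols_toCols R, conjTranspose_fromCols_eq_fromRows_conjTranspose,
    fromRows_mul_fromCols] at hR
  obtain ⟨-, -, hB, hD⟩ := fromBlocks_inj.mp hR
  rw [hB, hD]
  exact exists_transpose_mul_self_mul_eq _ _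

/-- Theorem 2 (Albert's conditions / generalized Schur complement):
the symmetric block matrix `[[Y₁₁, Y₁₂], [Y₁₂ᵀ, Y₂₂]]` is positive semidefinite
iff `Y₂₂` is positive semidefinite and there is `W` with `Y₂₂ W = Y₁₂ᵀ` and
`Y₁₁ − Y₁₂ W` positive semidefinite. -/
theorem stmt2 (m n : ℕ) (hm : 1 ≤ m) (hn : 1 ≤ n)
    (Y11 : Matrix (Fin m) (Fin m) ℝ) (hY11 : Y11ᵀ = Y11)
    (Y22 : Matrix (Fin n) (Fin n) ℝ) (hY22 : Y22ᵀ = Y22)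
    (Y12 : Matrix (Fin m) (Fin n) ℝ) :
    (Matrix.fromBlocks Y11 Y12 Y12ᵀ Y22).PosSemidef ↔
      (Y22.PosSemidef ∧ ∃ W : Matrix (Fin n) (Fin m) ℝ,
        Y22 * W = Y12ᵀ ∧ (Y11 - Y12 * W).PosSemidef) := by
  constructor
  · intro h
    obtain ⟨W, hW⟩ := h.exists_mul_eq_of_fromBlocks
    refine ⟨h.submatrix Sum.inr, W, hW, ?_⟩
    have hS := h.conjTranspose_mul_mul_same (fromRows 1 (-W))
    rw [Matrix.mul_assoc, fromBlocks_mul_fromRows,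
      conjTranspose_fromRows_eq_fromCols_conjTranspose, fromCols_mul_fromRows] at hS
    simpa [hW, sub_eq_add_neg] using hS
  · rintro ⟨hD, W, hW, hS⟩
    have hWt : Wᵀ * Y22 = Y12 := by
      rw [← transpose_transpose Y12, ← hW, transpose_mul, hY22]
    have hsum := (hS.conjTranspose_mul_mul_same (fromCols 1 (0 : Matrix (Fin m) (Fin n) ℝ))).add
      (hD.conjTranspose_mul_mul_same (fromCols W 1))
    rw [conjTranspose_fromCols_eq_fromRows_conjTranspose,
      conjTranspose_fromCols_eq_fromRows_conjTranspose, fromRows_mul,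
      fromRows_mul_fromCols, fromRows_mul, fromRows_mul_fromCols] at hsum
    simpa [fromBlocks_add, Matrix.mul_assoc, hW, hWt] using hsum
end

section
/- Let n ≥ 1, let V_k and V_v be real symmetric positive semidefinite n×n matrices, let c_k, c_v ∈ ℝⁿ, let α_k, α_v > 0 and let T₁, σ_k, σ_v ∈ ℝ. Suppose there exist w_k, w_v ∈ ℝⁿ with V_k w_k = c_k, V_v w_v = c_v, and 2T₁ ≥ (σ_k²/α_k)(c_k · w_k) + (σ_v²/α_v)(c_v · w_v). Then the real symmetric (2+2n)×(2+2n) block matrix A, whose leading 2×2 block is [[2T₁, −2T₁], [−2T₁, 2T₁]], whose first two rows continue with the row vectors [σ_k c_kᵀ, −σ_v c_vᵀ] and [−σ_k c_kᵀ, σ_v c_vᵀ], whose first two columns continue with the column vectors [σ_k c_k; −σ_v c_v] and [−σ_k c_k; σ_v c_v], and whose trailing 2n×2n block is the block diagonal matrix diag(α_k V_k, α_v V_v), is positive semidefinite. -/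
open Matrix

/-- Completing the square: if `V` is positive semidefinite and `V w = c`, then the quadratic
`α yᵀVy + 2 s cᵀy` is bounded below by `-(s² / α) cᵀw`. -/
theorem Matrix.PosSemidef.quadratic_add_linear_nonneg {ι : Type*} [Fintype ι]
    {V : Matrix ι ι ℝ} (hV : V.PosSemidef) {c w : ι → ℝ} (hw : V *ᵥ w = c)
    {α : ℝ} (hα : 0 < α) (s : ℝ) (y : ι → ℝ) :
    0 ≤ α * (y ⬝ᵥ V *ᵥ y) + 2 * s * (c ⬝ᵥ y) + s ^ 2 / α * (c ⬝ᵥ w) := by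
  have hVT : Vᵀ = V := hV.isHermitian.eq
  have hwy : w ⬝ᵥ V *ᵥ y = c ⬝ᵥ y := by
    rw [dotProduct_mulVec, ← mulVec_transpose, hVT, hw]
  have h := (posSemidef_iff_dotProduct_mulVec.mp hV).2 (y + (s / α) • w)
  simp only [star_trivial, mulVec_add, mulVec_smul, add_dotProduct, dotProduct_add,
    smul_dotProduct, dotProduct_smul, smul_eq_mul, hw, hwy, dotProduct_comm _ c] at h
  refine (mul_nonneg hα.le h).trans_eq ?_
  field_simp
  ring

/-- The symmetric interface-penalty matrix `A` of the energy stability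
analysis is positive semidefinite under the stated solvability and
inequality conditions (conservative SBP-SAT discretizations). -/
theorem stmt3 (n : ℕ) (hn : 1 ≤ n)
    (Vk Vv : Matrix (Fin n) (Fin n) ℝ)
    (hVk : Vk.PosSemidef) (hVv : Vv.PosSemidef)
    (ck cv : Fin n → ℝ) (αk αv : ℝ) (hαk : 0 < αk) (hαv : 0 < αv)
    (T1 σk σv : ℝ)
    (wk wv : Fin n → ℝ) (hwk : Vk *ᵥ wk = ck) (hwv : Vv *ᵥ wv = cv)
    (hT1 : (σk ^ 2 / αk) * (ck ⬝ᵥ wk) + (σv ^ 2 / αv) * (cv ⬝ᵥ wv) ≤ 2 * T1) :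
    (Matrix.fromBlocks
      (!![2 * T1, -(2 * T1); -(2 * T1), 2 * T1])
      (Matrix.of fun (i : Fin 2) (j : Fin n ⊕ Fin n) => Sum.elim
        (fun a => (if i = 0 then σk else -σk) * ck a)
        (fun b => (if i = 0 then -σv else σv) * cv b) j)
      (Matrix.of fun (i : Fin n ⊕ Fin n) (j : Fin 2) => Sum.elim
        (fun a => (if j = 0 then σk else -σk) * ck a)
        (fun b => (if j = 0 then -σv else σv) * cv b) i)
      (Matrix.fromBlocks (αk • Vk) 0 0 (αv • Vv))).PosSemidef := by
  refine posSemidef_iff_dotProduct_mulVec.mpr ⟨?_, fun x => ?_⟩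
  · refine IsHermitian.fromBlocks ?_ ?_ (IsHermitian.fromBlocks ?_ ?_ ?_)
    · ext i j
      fin_cases i <;> fin_cases j <;> simp
    · ext i j
      rfl
    · exact (hVk.smul hαk.le).isHermitian
    · simp
    · exact (hVv.smul hαv.le).isHermitian
  · obtain ⟨u, y, z, rfl⟩ : ∃ (u : Fin 2 → ℝ) (y z : Fin n → ℝ), x = Sum.elim u (Sum.elim y z) :=
      ⟨x ∘ Sum.inl, x ∘ Sum.inr ∘ Sum.inl, x ∘ Sum.inr ∘ Sum.inr, by
        ext (i | i | i) <;> rfl⟩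
    set d := u 0 - u 1 with hd
    have h1 := hVk.quadratic_add_linear_nonneg hwk hαk (σk * d) y
    have h2 := hVv.quadratic_add_linear_nonneg hwv hαv (-(σv * d)) z
    have h3 := mul_le_mul_of_nonneg_right hT1 (sq_nonneg d)
    suffices h : star (Sum.elim u (Sum.elim y z)) ⬝ᵥ (_ *ᵥ Sum.elim u (Sum.elim y z)) =
        2 * T1 * d ^ 2 + 2 * (σk * d) * (ck ⬝ᵥ y) + 2 * (-(σv * d)) * (cv ⬝ᵥ z)
          + αk * (y ⬝ᵥ Vk *ᵥ y) + αv * (z ⬝ᵥ Vv *ᵥ z) by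
      rw [h]
      linear_combination h1 + h2 + h3
    have hB : (Matrix.of fun (i : Fin 2) (j : Fin n ⊕ Fin n) => Sum.elim
        (fun a => (if i = 0 then σk else -σk) * ck a)
        (fun b => (if i = 0 then -σv else σv) * cv b) j) *ᵥ Sum.elim y z =
        ![σk * (ck ⬝ᵥ y) - σv * (cv ⬝ᵥ z), -(σk * (ck ⬝ᵥ y) - σv * (cv ⬝ᵥ z))] := by
      ext i
      fin_cases i <;>
        simp [mulVec, dotProduct, Fintype.sum_sum_type, mul_assoc, ← Finset.mul_sum] <;> ring
    have hC : (Matrix.of fun (i : Fin n ⊕ Fin n) (j : Fin 2) => Sum.elim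
        (fun a => (if j = 0 then σk else -σk) * ck a)
        (fun b => (if j = 0 then -σv else σv) * cv b) i) *ᵥ u =
        Sum.elim ((σk * d) • ck) ((-(σv * d)) • cv) := by
      ext (i | i) <;> simp [mulVec, dotProduct, Fin.sum_univ_two, hd] <;> ring
    have hA : !![2 * T1, -(2 * T1); -(2 * T1), 2 * T1] *ᵥ u = ![2 * T1 * d, -(2 * T1 * d)] := by
      ext i
      fin_cases i <;> simp [mulVec, dotProduct, Fin.sum_univ_two, hd] <;> ring
    have hu (r : ℝ) : u ⬝ᵥ ![r, -r] = d * r := by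
      simp [dotProduct, Fin.sum_univ_two, hd]
      ring
    simp only [star_trivial, fromBlocks_mulVec, Sum.elim_comp_inl, Sum.elim_comp_inr, hA, hB, hC,
      sumElim_dotProduct_sumElim, dotProduct_add, hu, smul_mulVec, zero_mulVec, add_zero, zero_add,
      dotProduct_smul, smul_eq_mul, dotProduct_comm y ck, dotProduct_comm z cv]
    ring
end

section
/- Let n ≥ 1, let V_k and V_v be real symmetric positive semidefinite n×n matrices, let c_k, c_v ∈ ℝⁿ, let α_k, α_v > 0 and let T⁽¹⁾, T_k⁽²⁾, T_v⁽²⁾ ∈ ℝ. Suppose there exist w_k, w_v ∈ ℝⁿ with V_k w_k = c_k, V_v w_v = c_v, and T⁽¹⁾ ≥ (2/α_k) (T_k⁽²⁾)² (c_k · w_k) + (2/α_v) (T_v⁽²⁾)² (c_v · w_v). Then the real symmetric (2+2n)×(2+2n) block matrix A, whose leading 2×2 block is [[2T⁽¹⁾, −2T⁽¹⁾], [−2T⁽¹⁾, 2T⁽¹⁾]], whose first two rows continue with the row vectors [2T_k⁽²⁾ c_kᵀ, −2T_v⁽²⁾ c_vᵀ] and [−2T_k⁽²⁾ c_kᵀ,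 2T_v⁽²⁾ c_vᵀ], whose first two columns continue with the column vectors [2T_k⁽²⁾ c_k; −2T_v⁽²⁾ c_v] and [−2T_k⁽²⁾ c_k; 2T_v⁽²⁾ c_v], and whose trailing 2n×2n block is the block diagonal matrix diag(α_k V_k, α_v V_v), is positive semidefinite. -/
open Matrix

/-- Completing the square: for positive semidefinite `V`, the quadratic-plus-linear form
`y ↦ α yᵀVy + 2 s (Vw)ᵀy` is bounded below by `-(s² / α) (Vw)ᵀw`. -/
lemma Matrix.PosSemidef.complete_square_nonneg {ι : Type*} [Fintype ι] {V : Matrix ι ι ℝ}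
    (hV : V.PosSemidef) (w y : ι → ℝ) {α : ℝ} (hα : 0 < α) (s : ℝ) :
    0 ≤ α * (y ⬝ᵥ V *ᵥ y) + 2 * s * ((V *ᵥ w) ⬝ᵥ y) + s ^ 2 / α * ((V *ᵥ w) ⬝ᵥ w) := by
  have h := hV.dotProduct_mulVec_nonneg (y + (s / α) • w)
  have hsymm : w ⬝ᵥ V *ᵥ y = y ⬝ᵥ V *ᵥ w := by
    have hT : Vᵀ = V := by simpa using hV.isHermitian.eq
    rw [dotProduct_mulVec, ← mulVec_transpose, hT, dotProduct_comm]
  simp only [star_trivial, mulVec_add, mulVec_smul, dotProduct_add, add_dotProduct,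
    smul_dotProduct, dotProduct_smul, smul_eq_mul, hsymm] at h
  rw [dotProduct_comm _ y, dotProduct_comm _ w]
  have h' := mul_nonneg hα.le h
  refine h'.trans_eq ?_
  field_simp
  ring

/-- Theorem 3 interface condition: for adjoint consistent SBP-SAT
discretizations with `T⁽³⁾ − T⁽²⁾ = 1`, the interface-penalty matrix `A`
with off-diagonal coupling coefficients `2T⁽²⁾` is positive semidefinite. -/
theorem stmt4 (n : ℕ) (hn : 1 ≤ n)
    (Vk Vv : Matrix (Fin n) (Fin n) ℝ)
    (hVk : Vk.PosSemidef) (hVv : Vv.PosSemidef)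
    (ck cv : Fin n → ℝ) (αk αv : ℝ) (hαk : 0 < αk) (hαv : 0 < αv)
    (T1 Tk2 Tv2 : ℝ)
    (wk wv : Fin n → ℝ) (hwk : Vk *ᵥ wk = ck) (hwv : Vv *ᵥ wv = cv)
    (hT1 : (2 / αk) * Tk2 ^ 2 * (ck ⬝ᵥ wk) + (2 / αv) * Tv2 ^ 2 * (cv ⬝ᵥ wv) ≤ T1) :
    (Matrix.fromBlocks
      (!![2 * T1, -(2 * T1); -(2 * T1), 2 * T1])
      (Matrix.of fun (i : Fin 2) (j : Fin n ⊕ Fin n) => Sum.elim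
        (fun a => (if i = 0 then 2 * Tk2 else -(2 * Tk2)) * ck a)
        (fun b => (if i = 0 then -(2 * Tv2) else 2 * Tv2) * cv b) j)
      (Matrix.of fun (i : Fin n ⊕ Fin n) (j : Fin 2) => Sum.elim
        (fun a => (if j = 0 then 2 * Tk2 else -(2 * Tk2)) * ck a)
        (fun b => (if j = 0 then -(2 * Tv2) else 2 * Tv2) * cv b) i)
      (Matrix.fromBlocks (αk • Vk) 0 0 (αv • Vv))).PosSemidef := by
  have hVkT : Vkᵀ = Vk := by simpa using hVk.isHermitian.eq
  have hVvT : Vvᵀ = Vv := by simpa using hVv.isHermitian.eq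
  refine PosSemidef.of_dotProduct_mulVec_nonneg ?_ fun x => ?_
  · rw [isHermitian_fromBlocks_iff]
    refine ⟨?_, ?_, ?_, ?_⟩
    · ext i j
      fin_cases i <;> fin_cases j <;> simp
    · ext i j
      rcases i with a | b <;> simp
    · ext i j
      rcases j with a | b <;> simp
    · simp [IsHermitian, fromBlocks_transpose, hVkT, hVvT]
  · obtain ⟨u, yz, rfl⟩ : ∃ u yz, x = Sum.elim u yz := ⟨_, _, (Sum.elim_comp_inl_inr x).symm⟩
    obtain ⟨y, z, rfl⟩ : ∃ y z, yz = Sum.elim y z := ⟨_, _, (Sum.elim_comp_inl_inr yz).symm⟩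
    have hk := hVk.complete_square_nonneg wk y hαk (2 * Tk2 * (u 0 - u 1))
    have hv := hVv.complete_square_nonneg wv z hαv (-(2 * Tv2 * (u 0 - u 1)))
    rw [hwk] at hk
    rw [hwv] at hv
    have hd := mul_nonneg (sub_nonneg.2 hT1) (sq_nonneg (u 0 - u 1))
    have hform : 0 ≤ 2 * T1 * (u 0 - u 1) ^ 2 + 4 * Tk2 * (u 0 - u 1) * (ck ⬝ᵥ y)
        - 4 * Tv2 * (u 0 - u 1) * (cv ⬝ᵥ z) + αk * (y ⬝ᵥ Vk *ᵥ y) + αv * (z ⬝ᵥ Vv *ᵥ z) := by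
      have e := add_nonneg (add_nonneg hk hv) (mul_nonneg zero_le_two hd)
      refine e.trans_eq ?_
      field_simp
      ring
    refine hform.trans_eq (Eq.symm ?_)
    have hlow : (Sum.elim y z) ⬝ᵥ ((Matrix.of fun (i : Fin n ⊕ Fin n) (j : Fin 2) => Sum.elim
        (fun a => (if j = 0 then 2 * Tk2 else -(2 * Tk2)) * ck a)
        (fun b => (if j = 0 then -(2 * Tv2) else 2 * Tv2) * cv b) i) *ᵥ u)
        = 2 * Tk2 * (u 0 - u 1) * (ck ⬝ᵥ y) - 2 * Tv2 * (u 0 - u 1) * (cv ⬝ᵥ z) := by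
      simp only [dotProduct, mulVec, Fintype.sum_sum_type, Sum.elim_inl, Sum.elim_inr, of_apply,
        Fin.sum_univ_two, Finset.mul_sum, sub_eq_add_neg _ (∑ _, _), ← Finset.sum_neg_distrib]
      congr 1 <;> refine Finset.sum_congr rfl fun _ _ => ?_ <;> simp <;> ring
    have hup : u ⬝ᵥ ((Matrix.of fun (i : Fin 2) (j : Fin n ⊕ Fin n) => Sum.elim
        (fun a => (if i = 0 then 2 * Tk2 else -(2 * Tk2)) * ck a)
        (fun b => (if i = 0 then -(2 * Tv2) else 2 * Tv2) * cv b) j) *ᵥ Sum.elim y z)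
        = 2 * Tk2 * (u 0 - u 1) * (ck ⬝ᵥ y) - 2 * Tv2 * (u 0 - u 1) * (cv ⬝ᵥ z) := by
      rw [← hlow, dotProduct_mulVec, dotProduct_comm, ← mulVec_transpose]
      rfl
    rw [star_trivial, fromBlocks_mulVec, sumElim_dotProduct_sumElim]
    simp only [Sum.elim_comp_inl, Sum.elim_comp_inr, dotProduct_add, hlow, hup]
    rw [fromBlocks_mulVec, sumElim_dotProduct_sumElim]
    simp only [Sum.elim_comp_inl, Sum.elim_comp_inr, zero_mulVec, add_zero, zero_add,
      smul_mulVec, dotProduct_smul, smul_eq_mul]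
    simp only [dotProduct, mulVec, Fin.sum_univ_two, of_apply, cons_val_zero, cons_val_one]
    ring
end

section
/- Let n ≥ 1, let V_k and V_v be real symmetric positive semidefinite n×n matrices, let c_k, c_v ∈ ℝⁿ and α_k, α_v > 0, and suppose there exists w_k ∈ ℝⁿ with V_k w_k = c_k. Define T₁ = (2/α_k)(c_k · w_k). Then the real symmetric (2+2n)×(2+2n) block matrix whose leading 2×2 block is [[2T₁, −2T₁], [−2T₁, 2T₁]], whose first two rows continue with the row vectors [−2c_kᵀ, 0] and [2c_kᵀ, 0], whose first two columns continue with the column vectors [−2c_k; 0] and [2c_k; 0], and whose trailing 2n×2n block is diag(α_k V_k, α_v V_v), is positive semidefinite. -/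
open Matrix

/-- A block matrix whose trailing block `D` is positive semidefinite, whose off-diagonal blocks factor
through `D`, and whose Schur complement vanishes is positive semidefinite. -/
theorem Matrix.PosSemidef.fromBlocks_of_mul_eq {m p : Type*} [Fintype m] [Fintype p]
    {A : Matrix m m ℝ} {C : Matrix p m ℝ} {D : Matrix p p ℝ} (hD : D.PosSemidef)
    (W : Matrix p m ℝ) (hC : D * W = C) (hA : Wᵀ * C = A) :
    (fromBlocks A Cᵀ C D).PosSemidef := by
  classical
  have h := hD.conjTranspose_mul_mul_same (fromCols W (1 : Matrix p p ℝ))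
  have hDT : Dᵀ = D := by simpa using hD.isHermitian.eq
  have hCT : Wᵀ * D = Cᵀ := by rw [← hC, transpose_mul, hDT]
  rw [conjTranspose_fromCols_eq_fromRows_conjTranspose, Matrix.mul_assoc, mul_fromCols,
    fromRows_mul_fromCols] at h
  simpa [hC, hA, hCT] using h

/-- The block-diagonal matrix with positive semidefinite blocks is positive semidefinite. -/
theorem Matrix.PosSemidef.fromBlocks_zero {m p : Type*} [Fintype m] [Fintype p]
    {A : Matrix m m ℝ} {D : Matrix p p ℝ} (hA : A.PosSemidef) (hD : D.PosSemidef) :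
    (fromBlocks A 0 0 D).PosSemidef := by
  refine .of_dotProduct_mulVec_nonneg (hA.isHermitian.fromBlocks (by simp) hD.isHermitian) fun x => ?_
  rw [fromBlocks_mulVec, ← Sum.elim_comp_inl_inr (star x), sumElim_dotProduct_sumElim]
  simpa using add_nonneg (hA.dotProduct_mulVec_nonneg (x ∘ Sum.inl))
    (hD.dotProduct_mulVec_nonneg (x ∘ Sum.inr))

/-- Stability of the local discontinuous Galerkin (LDG) SAT coefficients:
with `T₁ = (2/α_k)(c_k·w_k)` the interface-penalty matrix is positive
semidefinite. -/
theorem stmt8 (n : ℕ) (hn : 1 ≤ n)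
    (Vk Vv : Matrix (Fin n) (Fin n) ℝ)
    (hVk : Vk.PosSemidef) (hVv : Vv.PosSemidef)
    (ck cv : Fin n → ℝ) (αk αv : ℝ) (hαk : 0 < αk) (hαv : 0 < αv)
    (wk : Fin n → ℝ) (hwk : Vk *ᵥ wk = ck)
    (T1 : ℝ) (hT1 : T1 = (2 / αk) * (ck ⬝ᵥ wk)) :
    (Matrix.fromBlocks
      (!![2 * T1, -(2 * T1); -(2 * T1), 2 * T1])
      (Matrix.of fun (i : Fin 2) (j : Fin n ⊕ Fin n) => Sum.elim
        (fun a => (if i = 0 then -(2 : ℝ) else (2 : ℝ)) * ck a)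
        (fun _ => (0 : ℝ)) j)
      (Matrix.of fun (i : Fin n ⊕ Fin n) (j : Fin 2) => Sum.elim
        (fun a => (if j = 0 then -(2 : ℝ) else (2 : ℝ)) * ck a)
        (fun _ => (0 : ℝ)) i)
      (Matrix.fromBlocks (αk • Vk) 0 0 (αv • Vv))).PosSemidef := by
  have hD := (hVk.smul hαk.le).fromBlocks_zero (hVv.smul hαv.le)
  have hα : αk ≠ 0 := hαk.ne'
  convert hD.fromBlocks_of_mul_eq
    (fromRows (vecMulVec wk ![-(2 / αk), 2 / αk]) (0 : Matrix (Fin n) (Fin 2) ℝ)) ?_ ?_ using 2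
  · ext i (a | a) <;> simp [Matrix.of_apply]
  · rw [fromBlocks_mul_fromRows]
    ext (a | a) j
    · rw [fromRows_apply_inl, Matrix.mul_zero, add_zero, mul_vecMulVec, smul_mulVec, hwk]
      fin_cases j <;> simp [vecMulVec_apply] <;> field_simp
    · simp
  · have hdot : ∑ a, wk a * ck a = ck ⬝ᵥ wk := by simp [dotProduct, mul_comm]
    ext i j
    fin_cases i <;> fin_cases j <;>
      simp [Matrix.mul_apply, hT1, ← hdot, Finset.mul_sum] <;>
      exact Finset.sum_congr rfl fun a _ => by ring
end

section
/- Let n ≥ 1 and let H, D⁽²⁾, B be real n×n matrices with H invertible, and let 𝟙, x ∈ ℝⁿ. Define M = B − H D⁽²⁾. Assume: (i) the kernel of D⁽²⁾ (as a linear map ℝⁿ → ℝⁿ) equals the span of {𝟙, x}; (ii) B𝟙 = 0; (iii) Bx ≠ 0; and (iv) for every v ∈ ℝⁿ with D⁽²⁾v ≠ 0 there exists an index i such that (H D⁽²⁾ v)ᵢ ≠ 0 and (B v)ᵢ = 0. Then the kernel of M equals the span of {𝟙}. -/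
open Matrix

/-- Lemma 1 (first part), abstract form: under nullspace consistency of
`D⁽²⁾` and the structural hypotheses on `B`, the kernel of `M = B − H D⁽²⁾`
is exactly the span of the constant vector. -/
theorem stmt11 (n : ℕ) (hn : 1 ≤ n)
    (H D2 B : Matrix (Fin n) (Fin n) ℝ) (hHinv : IsUnit H.det)
    (one x : Fin n → ℝ)
    (M : Matrix (Fin n) (Fin n) ℝ) (hM : M = B - H * D2)
    (hker : LinearMap.ker (Matrix.toLin' D2) = Submodule.span ℝ {one, x})
    (hB1 : B *ᵥ one = 0) (hBx : B *ᵥ x ≠ 0)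
    (hbnd : ∀ v : Fin n → ℝ, D2 *ᵥ v ≠ 0 →
      ∃ i, ((H * D2) *ᵥ v) i ≠ 0 ∧ (B *ᵥ v) i = 0) :
    LinearMap.ker (Matrix.toLin' M) = Submodule.span ℝ {one} := by
  have mulVec_M (v : Fin n → ℝ) : M *ᵥ v = B *ᵥ v - (H * D2) *ᵥ v := by
    rw [hM, sub_mulVec]
  have mem_ker_D2 (v : Fin n → ℝ) : D2 *ᵥ v = 0 ↔ v ∈ Submodule.span ℝ {one, x} := by
    rw [← hker, LinearMap.mem_ker, toLin'_apply]
  ext v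
  rw [LinearMap.mem_ker, toLin'_apply, mulVec_M, sub_eq_zero, Submodule.mem_span_singleton]
  constructor
  · intro hv
    have hD : D2 *ᵥ v = 0 := by
      by_contra hD
      obtain ⟨i, hi, hBi⟩ := hbnd v hD
      exact hi (by rw [← hv, hBi])
    obtain ⟨a, b, rfl⟩ := Submodule.mem_span_pair.1 ((mem_ker_D2 v).1 hD)
    rw [← mulVec_mulVec, hD, mulVec_zero, mulVec_add, mulVec_smul, mulVec_smul, hB1,
      smul_zero, zero_add] at hv
    have hb : b = 0 := (smul_eq_zero.1 hv).resolve_right hBx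
    exact ⟨a, by simp [hb]⟩
  · rintro ⟨a, rfl⟩
    have hD : D2 *ᵥ one = 0 := (mem_ker_D2 one).2 (Submodule.subset_span (by simp))
    rw [← mulVec_mulVec, mulVec_smul, mulVec_smul, hB1, hD, smul_zero, mulVec_zero]
end

section
/- Let n ≥ 1, let r_k, d_k, r_v, d_v be real 1×n matrices (row vectors), and let T₁ₖ, T₂ₖ, T₃ₖ, T₄ₖ, T₁ᵥ, T₂ᵥ, T₃ᵥ, T₄ᵥ be real numbers satisfying T₁ₖ = T₁ᵥ, T₂ₖ + 1 = −T₂ᵥ, T₃ₖ − 1 = −T₃ᵥ and T₄ₖ = T₄ᵥ. Define the n×n matrices A₁₂ = (r_kᵀ T₁ₖ + d_kᵀ T₂ₖ)(−r_v) + (r_kᵀ T₃ₖ + d_kᵀ T₄ₖ) d_v and B₂₁ = (r_vᵀ T₁ᵥ + d_vᵀ (T₃ᵥ − 1))(−r_k) + (r_vᵀ (T₂ᵥ + 1) + d_vᵀ T₄ᵥ) d_k. Then A₁₂ᵀ = B₂₁. Likewise, with A₂₁ = (r_vᵀ T₁ᵥ + d_vᵀ T₂ᵥ)(−r_k) + (r_vᵀ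 T₃ᵥ + d_vᵀ T₄ᵥ) d_k and B₁₂ = (r_kᵀ T₁ₖ + d_kᵀ (T₃ₖ − 1))(−r_v) + (r_kᵀ (T₂ₖ + 1) + d_kᵀ T₄ₖ) d_v, one has A₂₁ᵀ = B₁₂. -/
open Matrix

/-- Symmetry between the primal and adjoint interface SAT blocks: under the
adjoint consistency conditions, `𝔸₁₂ᵀ = 𝔹₂₁` and `𝔸₂₁ᵀ = 𝔹₁₂`. -/
theorem stmt13 (n : ℕ) (hn : 1 ≤ n)
    (rk dk rv dv : Matrix (Fin 1) (Fin n) ℝ)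
    (T1k T2k T3k T4k T1v T2v T3v T4v : ℝ)
    (h1 : T1k = T1v) (h2 : T2k + 1 = -T2v) (h3 : T3k - 1 = -T3v) (h4 : T4k = T4v)
    (A12 : Matrix (Fin n) (Fin n) ℝ)
    (hA12 : A12 = (T1k • rkᵀ + T2k • dkᵀ) * (-rv) + (T3k • rkᵀ + T4k • dkᵀ) * dv)
    (B21 : Matrix (Fin n) (Fin n) ℝ)
    (hB21 : B21 = (T1v • rvᵀ + (T3v - 1) • dvᵀ) * (-rk) + ((T2v + 1) • rvᵀ + T4v • dvᵀ) * dk)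
    (A21 : Matrix (Fin n) (Fin n) ℝ)
    (hA21 : A21 = (T1v • rvᵀ + T2v • dvᵀ) * (-rk) + (T3v • rvᵀ + T4v • dvᵀ) * dk)
    (B12 : Matrix (Fin n) (Fin n) ℝ)
    (hB12 : B12 = (T1k • rkᵀ + (T3k - 1) • dkᵀ) * (-rv) + ((T2k + 1) • rkᵀ + T4k • dkᵀ) * dv) :
    A12ᵀ = B21 ∧ A21ᵀ = B12 := by
  obtain rfl : T2v = -T2k - 1 := by linarith
  obtain rfl : T3v = 1 - T3k := by linarith
  subst h1 h4 hA12 hB21 hA21 hB12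
  constructor <;> ext i j <;>
    simp only [Matrix.mul_apply, Matrix.transpose_apply, Matrix.add_apply, Matrix.smul_apply,
      Matrix.neg_apply, Fin.sum_univ_one, smul_eq_mul] <;>
    ring
end
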